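/- arXiv:math/0408174 — 5 statements merged into one kernel-verified Lean document; each statement's English description precedes it below -/
import Mathlib

section
/- Let g : ℝ² → ℝ be defined by g(x) = (13 − u)(1075 + 220u + 69u²) e^{−π‖x‖²} where u = 2π‖x‖², and let ĝ(t) = (401 + 69w)(w − 7)² e^{−π‖t‖²} where w = 2π‖t‖². Then g(x) ≤ 0 for all x with ‖x‖ ≥ 1.62, and ĝ(t) ≥ 0 for all t ∈ ℝ². Moreover (ĝ(0) − g(0)) / g((4/3)^{1/4}) > 5.89, where g(r) for r ≥ 0 denotes the common value g(x) for ‖x‖ = r. -/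
open Real

/-- The radial profile of `g`: `G(r) = (13 − u)(1075 + 220u + 69u²) e^{−πr²}`
with `u = 2πr²`, so that `g(x) = G(‖x‖)`. -/
noncomputable def gRad (r : ℝ) : ℝ :=
  (13 - 2 * π * r ^ 2) * (1075 + 220 * (2 * π * r ^ 2) + 69 * (2 * π * r ^ 2) ^ 2)
    * Real.exp (-π * r ^ 2)

/-- The radial profile of `ĝ`: `Ĝ(r) = (401 + 69w)(w − 7)² e^{−πr²}` with
`w = 2πr²`, so that `ĝ(t) = Ĝ(‖t‖)`. -/
noncomputable def gHatRad (r : ℝ) : ℝ :=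
  (401 + 69 * (2 * π * r ^ 2)) * (2 * π * r ^ 2 - 7) ^ 2 * Real.exp (-π * r ^ 2)

theorem gRad_nonpos {r : ℝ} (hr : 1.62 ≤ r) : gRad r ≤ 0 := by
  have hr2 : 2.6 ≤ r ^ 2 := by nlinarith
  have hu : 13 ≤ 2 * π * r ^ 2 := by nlinarith [pi_gt_three]
  exact mul_nonpos_of_nonpos_of_nonneg
    (mul_nonpos_of_nonpos_of_nonneg (by linarith) (by positivity)) (exp_pos _).le

theorem gHatRad_nonneg (r : ℝ) : 0 ≤ gHatRad r := by
  unfold gHatRad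
  positivity

theorem lt_exp_three_point_six : 37.6 < Real.exp 3.6274 := by
  have h1 : Real.exp 3.6274 = Real.exp 1 ^ 3 * Real.exp 0.6274 := by
    rw [← Real.exp_nat_mul, ← Real.exp_add]
    norm_num
  have h2 : 1.8725 ≤ Real.exp 0.6274 := by
    refine le_trans ?_ (Real.sum_le_exp_of_nonneg (by norm_num : (0 : ℝ) ≤ 0.6274) 6)
    norm_num [Finset.sum_range_succ, Nat.factorial]
  have h3 : (2.71828 : ℝ) ^ 3 ≤ Real.exp 1 ^ 3 := by
    gcongr
    linarith [Real.exp_one_gt_d9]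
  rw [h1]
  nlinarith

theorem sq_rpow_quarter_mem_Ioo :
    (((4 : ℝ) / 3) ^ ((1 : ℝ) / 4)) ^ 2 ∈ Set.Ioo (1.1547 : ℝ) 1.15471 := by
  set s : ℝ := (((4 : ℝ) / 3) ^ ((1 : ℝ) / 4)) ^ 2
  have hs0 : 0 ≤ s := by positivity
  have hs : s ^ 2 = 4 / 3 := by
    rw [← pow_mul, ← Real.rpow_natCast, ← Real.rpow_mul (by norm_num)]
    norm_num
  constructor <;> nlinarith

theorem gRad_bounds {r : ℝ} (hr : r ^ 2 ∈ Set.Ioo (1.1547 : ℝ) 1.15471) :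
    0 < gRad r ∧ 5.89 * gRad r < 5674 := by
  obtain ⟨h1, h2⟩ := hr
  have hlo : 3.6274 < π * r ^ 2 := by nlinarith [pi_gt_d4]
  have hhi : π * r ^ 2 < 3.6277 := by nlinarith [pi_lt_d4]
  have hg : gRad r = (13 - 2 * (π * r ^ 2)) *
      (1075 + 220 * (2 * (π * r ^ 2)) + 69 * (2 * (π * r ^ 2)) ^ 2) /
        Real.exp (π * r ^ 2) := by
    rw [gRad, neg_mul, Real.exp_neg, div_eq_mul_inv, mul_assoc 2 π]
  rw [hg]
  generalize π * r ^ 2 = v at hlo hhi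
  have hexp : 37.6 < Real.exp v :=
    lt_exp_three_point_six.trans (Real.exp_lt_exp.mpr hlo)
  have hfactor : 0 < 13 - 2 * v := by linarith
  have hquad : 0 < 1075 + 220 * (2 * v) + 69 * (2 * v) ^ 2 := by positivity
  refine ⟨by positivity, ?_⟩
  have hprod : (13 - 2 * v) * (1075 + 220 * (2 * v) + 69 * (2 * v) ^ 2) ≤
      (13 - 2 * 3.6274) * (1075 + 220 * (2 * 3.6277) + 69 * (2 * 3.6277) ^ 2) := by
    gcongr
  rw [← mul_div_assoc, div_lt_iff₀ (exp_pos v)]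
  linarith

/-- `g(x) ≤ 0` for `‖x‖ ≥ 1.62`, `ĝ(t) ≥ 0` for all `t`, and
`(ĝ(0) − g(0)) / g((4/3)^{1/4}) > 5.89`. -/
theorem g_properties :
    (∀ x : EuclideanSpace ℝ (Fin 2), 1.62 ≤ ‖x‖ → gRad ‖x‖ ≤ 0) ∧
    (∀ t : EuclideanSpace ℝ (Fin 2), 0 ≤ gHatRad ‖t‖) ∧
    (gHatRad 0 - gRad 0) / gRad (((4 : ℝ) / 3) ^ ((1 : ℝ) / 4)) > 5.89 := by
  refine ⟨fun x hx => gRad_nonpos hx, fun t => gHatRad_nonneg _, ?_⟩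
  obtain ⟨hpos, hlt⟩ := gRad_bounds sq_rpow_quarter_mem_Ioo
  have h0 : gHatRad 0 - gRad 0 = 5674 := by norm_num [gHatRad, gRad]
  rw [h0, gt_iff_lt, lt_div_iff₀ hpos]
  exact hlt
end

section
/- Let Λ ⊂ ℝ² be a lattice with covolume 1 all of whose nonzero vectors have length at least (4/3)^{1/4}. Then the set of nearly minimal vectors of Λ, i.e. {x ∈ Λ : (4/3)^{1/4} ≤ ‖x‖ < 1.114}, has at most six elements. -/
open MeasureTheory

/-- The determinant of a pair of vectors of the plane. -/
def planeDet (x y : EuclideanSpace ℝ (Fin 2)) : ℝ := x 0 * y 1 - x 1 * y 0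

theorem exists_int_planeDet_eq (Λ : Submodule ℤ (EuclideanSpace ℝ (Fin 2)))
    [DiscreteTopology Λ] [IsZLattice ℝ Λ] (hcovol : ZLattice.covolume Λ = 1)
    {x y : EuclideanSpace ℝ (Fin 2)} (hx : x ∈ Λ) (hy : y ∈ Λ) :
    ∃ n : ℤ, planeDet x y = n := by
  have hfree : Module.Free ℤ Λ := ZLattice.module_free ℝ Λ
  have hfin : Module.Finite ℤ Λ := ZLattice.module_finite ℝ Λ
  have hrank : Module.finrank ℤ Λ = 2 := by rw [ZLattice.rank ℝ Λ]; simp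
  let b : Module.Basis (Fin 2) ℤ Λ := Module.finBasisOfFinrankEq ℤ Λ hrank
  let e := EuclideanSpace.basisFun (Fin 2) ℝ
  have hvol : volume.real (ZSpan.fundamentalDomain e.toBasis) = 1 := by
    rw [Measure.real, measure_congr (ZSpan.fundamentalDomain_ae_parallelepiped e.toBasis volume),
      OrthonormalBasis.coe_toBasis, OrthonormalBasis.volume_parallelepiped]
    simp
  have hdet : |planeDet (b 0) (b 1)| = 1 := by
    have h := ZLattice.covolume_eq_det_mul_measureReal Λ volume b e.toBasis
    rw [hcovol, hvol, mul_one, Module.Basis.det_apply, Matrix.det_fin_two] at h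
    rw [h, planeDet]
    simp [Module.Basis.toMatrix_apply, e]
    ring_nf
  have hcoord : ∀ z ∈ Λ, ∃ m n : ℤ, ∀ i, z i = m * (b 0 : EuclideanSpace ℝ (Fin 2)) i
      + n * (b 1 : EuclideanSpace ℝ (Fin 2)) i := by
    intro z hz
    have h := b.sum_repr ⟨z, hz⟩
    rw [Fin.sum_univ_two] at h
    refine ⟨b.repr ⟨z, hz⟩ 0, b.repr ⟨z, hz⟩ 1, fun i => ?_⟩
    have h := congrArg (fun v : Λ => (v : EuclideanSpace ℝ (Fin 2)) i) h.symm
    refine h.trans ?_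
    simp [← Int.cast_smul_eq_zsmul ℝ]
  obtain ⟨m, n, hmn⟩ := hcoord x hx
  obtain ⟨k, l, hkl⟩ := hcoord y hy
  have hxy : planeDet x y = (m * l - n * k) * planeDet (b 0) (b 1) := by
    simp only [planeDet, hmn, hkl]; ring
  rcases eq_or_eq_neg_of_abs_eq hdet with h | h
  · exact ⟨m * l - n * k, by rw [hxy, h]; push_cast; ring⟩
  · exact ⟨-(m * l - n * k), by rw [hxy, h]; push_cast; ring⟩

theorem norm_sq_plane (x : EuclideanSpace ℝ (Fin 2)) : ‖x‖ ^ 2 = x 0 ^ 2 + x 1 ^ 2 := by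
  rw [EuclideanSpace.real_norm_sq_eq, Fin.sum_univ_two]

theorem inner_plane (x y : EuclideanSpace ℝ (Fin 2)) :
    inner ℝ x y = x 0 * y 0 + x 1 * y 1 := by
  rw [PiLp.inner_apply, Fin.sum_univ_two]; simp [mul_comm]

theorem inner_sq_add_planeDet_sq (x y : EuclideanSpace ℝ (Fin 2)) :
    inner ℝ x y ^ 2 + planeDet x y ^ 2 = ‖x‖ ^ 2 * ‖y‖ ^ 2 := by
  rw [norm_sq_plane, norm_sq_plane, inner_plane, planeDet]; ring

theorem planeDet_sub_right (x y z : EuclideanSpace ℝ (Fin 2)) :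
    planeDet x (y - z) = planeDet x y - planeDet x z := by
  simp only [planeDet, PiLp.sub_apply]; ring

/-- Two short vectors having the same integral determinant with `x` and lying on the same side
of the line orthogonal to `x` are at distance less than `1`. -/
theorem norm_sub_lt_one {x y z : EuclideanSpace ℝ (Fin 2)} {n : ℤ}
    (hx : 1 ≤ ‖x‖) (hx' : ‖x‖ < 1.114) (hy : 1 ≤ ‖y‖) (hy' : ‖y‖ < 1.114)
    (hz : 1 ≤ ‖z‖) (hz' : ‖z‖ < 1.114) (hxy : planeDet x y = n) (hxz : planeDet x z = n)
    (hside : 0 ≤ inner ℝ x y ↔ 0 ≤ inner ℝ x z) : ‖y - z‖ < 1 := by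
  have hyz := inner_sq_add_planeDet_sq x (y - z)
  rw [planeDet_sub_right, hxy, hxz, sub_self, inner_sub_right] at hyz
  have hY := inner_sq_add_planeDet_sq x y
  have hZ := inner_sq_add_planeDet_sq x z
  rw [hxy] at hY
  rw [hxz] at hZ
  have hside' : 0 ≤ inner ℝ x y * inner ℝ x z := by
    by_cases h : 0 ≤ inner ℝ x y
    · exact mul_nonneg h (hside.1 h)
    · exact (mul_pos_of_neg_of_neg (not_le.1 h) (not_le.1 (mt hside.2 h))).le
  have sq_bounds : ∀ v : EuclideanSpace ℝ (Fin 2), 1 ≤ ‖v‖ → ‖v‖ < 1.114 →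
      1 ≤ ‖v‖ ^ 2 ∧ ‖v‖ ^ 2 < 1.25 := fun v h h' => ⟨by nlinarith, by nlinarith⟩
  obtain ⟨hx, hx'⟩ := sq_bounds x hx hx'
  obtain ⟨hy, hy'⟩ := sq_bounds y hy hy'
  obtain ⟨hz, hz'⟩ := sq_bounds z hz hz'
  generalize inner ℝ x y = s at *
  generalize inner ℝ x z = t at *
  generalize ‖x‖ ^ 2 = N at *
  generalize ‖y‖ ^ 2 = A at *
  generalize ‖z‖ ^ 2 = B at *
  have hA : N * A < 1.25 * N := by nlinarith
  have hB : N * B < 1.25 * N := by nlinarith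
  have key : (s - t) ^ 2 < N := by
    rcases eq_or_ne n 0 with rfl | hn
    · have hst : N ≤ s * t := by
        refine le_of_sq_le_sq ?_ hside'
        have : (s * t) ^ 2 = (N * A) * (N * B) := by rw [← hY, ← hZ]; push_cast; ring
        rw [this, sq]
        exact mul_le_mul (by nlinarith) (by nlinarith) (by linarith) (by nlinarith)
      push_cast at hY hZ
      nlinarith
    · have hn : (1 : ℝ) ≤ (n : ℝ) ^ 2 := by
        have : (0 : ℤ) < n ^ 2 := by positivity
        exact_mod_cast Int.add_one_le_iff.2 this
      rcases le_total (s ^ 2) (t ^ 2) with h | h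
      · have : s ^ 2 ≤ s * t := by
          refine le_of_sq_le_sq ?_ hside'
          nlinarith [sq_nonneg s]
        nlinarith
      · have : t ^ 2 ≤ s * t := by
          refine le_of_sq_le_sq ?_ hside'
          nlinarith [sq_nonneg t]
        nlinarith
  have : ‖y - z‖ ^ 2 < 1 := by nlinarith
  nlinarith [norm_nonneg (y - z)]

/-- A lattice in `ℝ²` of covolume `1` whose nonzero vectors all have length at
least `(4/3)^{1/4}` has at most six nearly minimal vectors, i.e. vectors `x`
with `(4/3)^{1/4} ≤ ‖x‖ < 1.114`. -/
theorem at_most_six_nearly_minimal (Λ : Submodule ℤ (EuclideanSpace ℝ (Fin 2)))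
    [DiscreteTopology Λ] [IsZLattice ℝ Λ]
    (hcovol : ZLattice.covolume Λ = 1)
    (hmin : ∀ x ∈ Λ, x ≠ 0 → ((4 : ℝ) / 3) ^ ((1 : ℝ) / 4) ≤ ‖x‖) :
    {x : EuclideanSpace ℝ (Fin 2) |
        x ∈ Λ ∧ ((4 : ℝ) / 3) ^ ((1 : ℝ) / 4) ≤ ‖x‖ ∧ ‖x‖ < 1.114}.Finite ∧
    {x : EuclideanSpace ℝ (Fin 2) |
        x ∈ Λ ∧ ((4 : ℝ) / 3) ^ ((1 : ℝ) / 4) ≤ ‖x‖ ∧ ‖x‖ < 1.114}.ncard ≤ 6 := by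
  have hc : (1 : ℝ) ≤ ((4 : ℝ) / 3) ^ ((1 : ℝ) / 4) :=
    Real.one_le_rpow (by norm_num) (by norm_num)
  generalize ((4 : ℝ) / 3) ^ ((1 : ℝ) / 4) = c at *
  set S := {x : EuclideanSpace ℝ (Fin 2) | x ∈ Λ ∧ c ≤ ‖x‖ ∧ ‖x‖ < 1.114}
  rcases S.eq_empty_or_nonempty with h | ⟨x, hxΛ, hxc, hx⟩
  · simp [h]
  let T : Finset (ℤ × Bool) := Finset.Icc (-1) 1 ×ˢ Finset.univ
  let f : EuclideanSpace ℝ (Fin 2) → ℤ × Bool := fun y =>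
    (⌊planeDet x y⌋, decide (0 ≤ inner ℝ x y))
  have hmaps : ∀ y ∈ S, f y ∈ (T : Set (ℤ × Bool)) := by
    rintro y ⟨hyΛ, hyc, hy⟩
    obtain ⟨n, hn⟩ := exists_int_planeDet_eq Λ hcovol hxΛ hyΛ
    have hxy := inner_sq_add_planeDet_sq x y
    have hlt : ‖x‖ * ‖y‖ < 2 := by nlinarith
    have hn2 : (n : ℝ) ^ 2 < 2 ^ 2 := by
      rw [← hn]
      nlinarith [sq_nonneg (inner ℝ x y), mul_nonneg (norm_nonneg x) (norm_nonneg y)]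
    have hn2 : n ^ 2 < 2 ^ 2 := by exact_mod_cast hn2
    have := abs_lt_of_sq_lt_sq' hn2 (by norm_num)
    simp only [T, f, hn, Int.floor_intCast, Finset.coe_product, Set.mem_prod, Finset.mem_coe,
      Finset.mem_Icc, Finset.mem_univ, and_true]
    omega
  have hinj : Set.InjOn f S := by
    rintro y ⟨hyΛ, hyc, hy⟩ z ⟨hzΛ, hzc, hz⟩ hyz
    obtain ⟨n, hn⟩ := exists_int_planeDet_eq Λ hcovol hxΛ hyΛ
    obtain ⟨m, hm⟩ := exists_int_planeDet_eq Λ hcovol hxΛ hzΛ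
    simp only [f, hn, hm, Int.floor_intCast, Prod.mk.injEq, decide_eq_decide] at hyz
    obtain ⟨rfl, hside⟩ := hyz
    by_contra hne
    have hle := hmin (y - z) (Λ.sub_mem hyΛ hzΛ) (sub_ne_zero.2 hne)
    have hlt := norm_sub_lt_one (hc.trans hxc) hx (hc.trans hyc) hy (hc.trans hzc) hz hn hm hside
    linarith
  refine ⟨Set.Finite.of_injOn hmaps hinj T.finite_toSet, ?_⟩
  calc S.ncard ≤ (T : Set (ℤ × Bool)).ncard :=
        Set.ncard_le_ncard_of_injOn f hmaps hinj T.finite_toSet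
    _ = 6 := by rw [Set.ncard_coe_finset]; rfl
end

section
/- Let Λ ⊂ ℝ² be a lattice with covolume 1 all of whose nonzero vectors have length at least (4/3)^{1/4}. Then no vector x ∈ Λ satisfies 1.114 ≤ ‖x‖ ≤ 1.62; that is, every nonzero vector of Λ is either nearly minimal or has length greater than 1.62. -/
open MeasureTheory

/-- A `ℤ`-basis of a planar lattice of covolume `1` has determinant `±1`. -/
lemma ZLattice.sq_det_basis_eq_one (Λ : Submodule ℤ (EuclideanSpace ℝ (Fin 2)))
    [DiscreteTopology Λ] [IsZLattice ℝ Λ] (hcovol : ZLattice.covolume Λ = 1)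
    (b : Module.Basis (Fin 2) ℤ Λ) :
    ((b 0 : EuclideanSpace ℝ (Fin 2)) 0 * (b 1 : EuclideanSpace ℝ (Fin 2)) 1 -
      (b 1 : EuclideanSpace ℝ (Fin 2)) 0 * (b 0 : EuclideanSpace ℝ (Fin 2)) 1) ^ 2 = 1 := by
  let e := EuclideanSpace.basisFun (Fin 2) ℝ
  have hvol : volume.real (ZSpan.fundamentalDomain e.toBasis) = 1 := by
    rw [measureReal_congr (ZSpan.fundamentalDomain_ae_parallelepiped e.toBasis volume),
      e.coe_toBasis, measureReal_def, e.volume_parallelepiped, ENNReal.toReal_one]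
  rw [ZLattice.covolume_eq_det_mul_measureReal Λ volume b e.toBasis, hvol, mul_one,
    Module.Basis.det_apply, Matrix.det_fin_two] at hcovol
  have habs := congrArg (· ^ 2) hcovol
  simpa [Module.Basis.toMatrix_apply, e] using habs

/-- In a planar lattice of covolume `1`, a vector that is not a proper multiple of a lattice vector
extends to a pair of lattice vectors spanning a parallelogram of area `1`. -/
lemma ZLattice.exists_sq_det_eq_one (Λ : Submodule ℤ (EuclideanSpace ℝ (Fin 2)))
    [DiscreteTopology Λ] [IsZLattice ℝ Λ] (hcovol : ZLattice.covolume Λ = 1)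
    {x : EuclideanSpace ℝ (Fin 2)} (hx : x ∈ Λ)
    (hprim : ∀ z ∈ Λ, ∀ n : ℤ, x = n • z → IsUnit n) :
    ∃ y ∈ Λ, (x 0 * y 1 - y 0 * x 1) ^ 2 = 1 := by
  have := ZLattice.module_finite ℝ Λ
  have := ZLattice.module_free ℝ Λ
  let b : Module.Basis (Fin 2) ℤ Λ :=
    Module.finBasisOfFinrankEq ℤ Λ (by rw [ZLattice.rank ℝ Λ]; simp)
  set i := b.repr ⟨x, hx⟩ 0
  set j := b.repr ⟨x, hx⟩ 1
  have hxij : x = i • (b 0 : EuclideanSpace ℝ (Fin 2)) + j • (b 1 : EuclideanSpace ℝ (Fin 2)) := by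
    have h := congrArg Subtype.val (b.sum_repr ⟨x, hx⟩)
    rw [Fin.sum_univ_two] at h
    exact h.symm
  have hcop : IsCoprime i j := by
    rw [Int.isCoprime_iff_gcd_eq_one]
    obtain ⟨k, hk⟩ := Int.gcd_dvd_left i j
    obtain ⟨l, hl⟩ := Int.gcd_dvd_right i j
    have h := hprim _ (Λ.add_mem (Λ.smul_mem k (b 0).2) (Λ.smul_mem l (b 1).2)) (Int.gcd i j) (by
      rw [smul_add, smul_smul, smul_smul, ← hk, ← hl]; exact hxij)
    simpa [Int.isUnit_iff_natAbs_eq] using h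
  obtain ⟨u, v, huv⟩ := hcop
  refine ⟨_, Λ.add_mem (Λ.smul_mem (-v) (b 0).2) (Λ.smul_mem u (b 1).2), ?_⟩
  have hdet := ZLattice.sq_det_basis_eq_one Λ hcovol b
  have huv' : (u * i + v * j : ℝ) = 1 := by exact_mod_cast huv
  rw [hxij]
  simp only [PiLp.add_apply, PiLp.smul_apply, zsmul_eq_mul, Int.cast_neg]
  rw [← hdet]
  generalize (b 0 : EuclideanSpace ℝ (Fin 2)) 0 = p at *
  generalize (b 0 : EuclideanSpace ℝ (Fin 2)) 1 = q at *
  generalize (b 1 : EuclideanSpace ℝ (Fin 2)) 0 = r at *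
  generalize (b 1 : EuclideanSpace ℝ (Fin 2)) 1 = s at *
  calc _ = ((u * i + v * j : ℝ) * (p * s - r * q)) ^ 2 := by ring
    _ = _ := by rw [huv', one_mul]

/-- If every translate of `y` by a multiple of `x` has squared length at least `M`, where `x` and
`y` span a parallelogram of area `1` and `3 * M ^ 2 = 4`, then the squared length of `x` does not
lie strictly between `M` and `3 * M`. -/
lemma sq_norm_le_or_ge_of_sq_det_eq_one {x y : EuclideanSpace ℝ (Fin 2)} {M : ℝ}
    (hM : 3 * M ^ 2 = 4) (hdet : (x 0 * y 1 - y 0 * x 1) ^ 2 = 1)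
    (hmin : ∀ k : ℤ, M ≤ ‖y - k • x‖ ^ 2) :
    ‖x‖ ^ 2 ≤ M ∨ 3 * M ≤ ‖x‖ ^ 2 := by
  have hA : ‖x‖ ^ 2 = x 0 ^ 2 + x 1 ^ 2 := by simp [EuclideanSpace.real_norm_sq_eq]
  set A := ‖x‖ ^ 2
  set B := x 0 * y 0 + x 1 * y 1 with hB
  have hA0 : 0 < A := by
    rw [hA]
    by_contra! h
    have h0 : x 0 = 0 := by nlinarith [sq_nonneg (x 0), sq_nonneg (x 1)]
    have h1 : x 1 = 0 := by nlinarith [sq_nonneg (x 0), sq_nonneg (x 1)]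
    simp [h0, h1] at hdet
  let k := round (B / A)
  have hk : ‖y - k • x‖ ^ 2 = (y 0 - k * x 0) ^ 2 + (y 1 - k * x 1) ^ 2 := by
    simp [EuclideanSpace.real_norm_sq_eq]
  have hgram : A * ‖y - k • x‖ ^ 2 = 1 + (B - k * A) ^ 2 := by
    rw [hk, hA, hB, ← hdet]; ring
  have hround : (B - k * A) ^ 2 ≤ A ^ 2 / 4 := by
    have h : (B / A - k) ^ 2 ≤ (1 / 2) ^ 2 := by
      rw [← sq_abs]; gcongr; exact abs_sub_round _
    calc (B - k * A) ^ 2 = (B / A - k) ^ 2 * A ^ 2 := by field_simp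
      _ ≤ (1 / 2) ^ 2 * A ^ 2 := by gcongr
      _ = A ^ 2 / 4 := by ring
  have := mul_le_mul_of_nonneg_left (hmin k) hA0.le
  by_contra! h
  nlinarith [mul_pos (sub_pos.2 h.1) (sub_pos.2 h.2)]

/-- In a lattice in `ℝ²` of covolume `1` whose nonzero vectors all have length
at least `(4/3)^{1/4}`, no vector has length in `[1.114, 1.62]`. -/
theorem no_middle_length_vectors (Λ : Submodule ℤ (EuclideanSpace ℝ (Fin 2)))
    [DiscreteTopology Λ] [IsZLattice ℝ Λ]
    (hcovol : ZLattice.covolume Λ = 1)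
    (hmin : ∀ x ∈ Λ, x ≠ 0 → ((4 : ℝ) / 3) ^ ((1 : ℝ) / 4) ≤ ‖x‖) :
    ∀ x ∈ Λ, ¬ (1.114 ≤ ‖x‖ ∧ ‖x‖ ≤ 1.62) := by
  rintro x hx ⟨h1, h2⟩
  set m := ((4 : ℝ) / 3) ^ ((1 : ℝ) / 4) with hm
  have hm0 : 0 < m := by positivity
  have hm4 : 3 * (m ^ 2) ^ 2 = 4 := by
    have h : m ^ 4 = 4 / 3 := by
      rw [hm, ← Real.rpow_natCast, ← Real.rpow_mul (by norm_num)]; norm_num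
    linear_combination 3 * h
  have hm1 : 1 < m := Real.one_lt_rpow (by norm_num) (by norm_num)
  have hx0 : x ≠ 0 := by rintro rfl; norm_num at h1
  have hprim : ∀ z ∈ Λ, ∀ n : ℤ, x = n • z → IsUnit n := by
    intro z hz n hn
    have hz0 : z ≠ 0 := by rintro rfl; exact hx0 (by simpa using hn)
    have hn0 : n ≠ 0 := by rintro rfl; exact hx0 (by simpa using hn)
    have hnorm : ‖x‖ = |(n : ℝ)| * ‖z‖ := by
      rw [hn, ← Int.cast_smul_eq_zsmul ℝ, norm_smul, Real.norm_eq_abs]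
    have hlt : |(n : ℝ)| < 2 := by
      nlinarith [hmin z hz hz0, abs_nonneg (n : ℝ)]
    have hlt' : |n| < 2 := by exact_mod_cast hlt
    rw [Int.isUnit_iff_abs_eq]
    have := abs_pos.2 hn0
    lia
  obtain ⟨y, hy, hdet⟩ := ZLattice.exists_sq_det_eq_one Λ hcovol hx hprim
  have hshift : ∀ k : ℤ, m ^ 2 ≤ ‖y - k • x‖ ^ 2 := by
    intro k
    gcongr
    refine hmin _ (Λ.sub_mem hy (Λ.smul_mem k hx)) fun h ↦ ?_
    rw [sub_eq_zero.1 h] at hdet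
    simp only [PiLp.smul_apply, zsmul_eq_mul] at hdet
    ring_nf at hdet
    norm_num at hdet
  rcases sq_norm_le_or_ge_of_sq_det_eq_one hm4 hdet hshift with h | h
  · have hlow : (1.114 : ℝ) ^ 2 ≤ ‖x‖ ^ 2 := by gcongr
    have : (1.114 ^ 2 : ℝ) ^ 2 ≤ (m ^ 2) ^ 2 :=
      pow_le_pow_left₀ (by positivity) (hlow.trans h) 2
    norm_num at this
    linarith
  · have hupp : ‖x‖ ^ 2 ≤ (1.62 : ℝ) ^ 2 := by gcongr
    nlinarith
end

section
/- Let Λ ⊂ ℝ² be a lattice with covolume 1 all of whose nonzero vectors have length at least (4/3)^{1/4}. Then the set of nearly minimal vectors {x ∈ Λ : (4/3)^{1/4} ≤ ‖x‖ < 1.114} has more than five elements (hence, combined with the upper bound, exactly six). -/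
open MeasureTheory

namespace NearlyMinimal

/-- The signed area spanned by two vectors of the plane. -/
def area (u v : EuclideanSpace ℝ (Fin 2)) : ℝ := u 0 * v 1 - u 1 * v 0

theorem norm_sq_coord (u : EuclideanSpace ℝ (Fin 2)) : ‖u‖ ^ 2 = u 0 ^ 2 + u 1 ^ 2 := by
  simp [EuclideanSpace.real_norm_sq_eq]

/-- A lattice of covolume `1` in the plane contains two vectors spanning area `±1`. -/
theorem exists_area_sq_eq_one (Λ : Submodule ℤ (EuclideanSpace ℝ (Fin 2)))
    [DiscreteTopology Λ] [IsZLattice ℝ Λ] (hcovol : ZLattice.covolume Λ = 1) :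
    ∃ u ∈ Λ, ∃ v ∈ Λ, area u v ^ 2 = 1 := by
  let b : Module.Basis (Fin 2) ℤ Λ := Module.finBasisOfFinrankEq ℤ Λ (by
    rw [ZLattice.rank ℝ, finrank_euclideanSpace_fin])
  let e := EuclideanSpace.basisFun (Fin 2) ℝ
  have h := ZLattice.covolume_eq_det_mul_measureReal Λ volume b e.toBasis
  have hvol : volume.real (ZSpan.fundamentalDomain e.toBasis) = 1 := by
    rw [measureReal_congr (ZSpan.fundamentalDomain_ae_parallelepiped e.toBasis volume),
      measureReal_def, OrthonormalBasis.coe_toBasis, e.volume_parallelepiped, ENNReal.toReal_one]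
  rw [hcovol, hvol, mul_one, Module.Basis.det_apply, Matrix.det_fin_two] at h
  refine ⟨b 0, (b 0).2, b 1, (b 1).2, ?_⟩
  rw [← sq_abs, show area (b 0) (b 1) = (b 0).1 0 * (b 1).1 1 - (b 1).1 0 * (b 0).1 1 by
    simp only [area]; ring]
  simp only [Module.Basis.toMatrix_apply, Function.comp_apply, e,
    OrthonormalBasis.coe_toBasis_repr_apply, EuclideanSpace.basisFun_repr] at h
  rw [← h, one_pow]

/-- Among the pairs of vectors of a discrete subgroup spanning area `±1`, one minimizes the sum of
the squared lengths. -/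
theorem exists_minimal_pair (Λ : Submodule ℤ (EuclideanSpace ℝ (Fin 2)))
    [DiscreteTopology Λ] (hne : ∃ u ∈ Λ, ∃ v ∈ Λ, area u v ^ 2 = 1) :
    ∃ u ∈ Λ, ∃ v ∈ Λ, area u v ^ 2 = 1 ∧ ∀ u' ∈ Λ, ∀ v' ∈ Λ, area u' v' ^ 2 = 1 →
      ‖u‖ ^ 2 + ‖v‖ ^ 2 ≤ ‖u'‖ ^ 2 + ‖v'‖ ^ 2 := by
  obtain ⟨u₀, hu₀, v₀, hv₀, h₀⟩ := hne
  let R : ℝ := ‖u₀‖ ^ 2 + ‖v₀‖ ^ 2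
  have hfin : (Metric.closedBall 0 (√R) ∩ (Λ : Set (EuclideanSpace ℝ (Fin 2)))).Finite := by
    have hd : DiscreteTopology Λ.toAddSubgroup := inferInstanceAs (DiscreteTopology Λ)
    exact Metric.finite_isBounded_inter_isClosed ⟨hd⟩ Metric.isBounded_closedBall
      (AddSubgroup.isClosed_of_discrete (H := Λ.toAddSubgroup))
  let S : Set (EuclideanSpace ℝ (Fin 2) × EuclideanSpace ℝ (Fin 2)) :=
    {p | p.1 ∈ Λ ∧ p.2 ∈ Λ ∧ area p.1 p.2 ^ 2 = 1 ∧ ‖p.1‖ ^ 2 + ‖p.2‖ ^ 2 ≤ R}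
  have hS : S.Finite := by
    refine (hfin.prod hfin).subset ?_
    rintro ⟨u, v⟩ ⟨hu, hv, -, hR⟩
    simp only at hu hv hR
    refine ⟨⟨?_, hu⟩, ⟨?_, hv⟩⟩
    · exact mem_closedBall_zero_iff.2 (Real.le_sqrt_of_sq_le (by nlinarith [sq_nonneg ‖v‖]))
    · exact mem_closedBall_zero_iff.2 (Real.le_sqrt_of_sq_le (by nlinarith [sq_nonneg ‖u‖]))
  obtain ⟨⟨u, v⟩, ⟨hu, hv, huv, hR⟩, hmin⟩ := Set.exists_min_image S
    (fun p => ‖p.1‖ ^ 2 + ‖p.2‖ ^ 2) hS ⟨(u₀, v₀), hu₀, hv₀, h₀, le_rfl⟩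
  refine ⟨u, hu, v, hv, huv, fun u' hu' v' hv' h' => ?_⟩
  by_cases hR' : ‖u'‖ ^ 2 + ‖v'‖ ^ 2 ≤ R
  · exact hmin (u', v') ⟨hu', hv', h', hR'⟩
  · exact hR.trans (not_le.1 hR').le

/-- The minimal pair may be chosen to span a non-acute angle. -/
theorem exists_minimal_obtuse_pair (Λ : Submodule ℤ (EuclideanSpace ℝ (Fin 2)))
    [DiscreteTopology Λ] (hne : ∃ u ∈ Λ, ∃ v ∈ Λ, area u v ^ 2 = 1) :
    ∃ u ∈ Λ, ∃ v ∈ Λ, area u v ^ 2 = 1 ∧ u 0 * v 0 + u 1 * v 1 ≤ 0 ∧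
      ∀ u' ∈ Λ, ∀ v' ∈ Λ, area u' v' ^ 2 = 1 → ‖u‖ ^ 2 + ‖v‖ ^ 2 ≤ ‖u'‖ ^ 2 + ‖v'‖ ^ 2 := by
  obtain ⟨u, hu, v, hv, huv, hmin⟩ := exists_minimal_pair Λ hne
  rcases le_total (u 0 * v 0 + u 1 * v 1) 0 with h | h
  · exact ⟨u, hu, v, hv, huv, h, hmin⟩
  · refine ⟨u, hu, -v, Λ.neg_mem hv, ?_, ?_, ?_⟩
    · rw [← huv]; simp only [area, PiLp.neg_apply]; ring
    · simp only [PiLp.neg_apply]; linarith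
    · simpa only [norm_neg] using hmin

/-- A reduced binary quadratic form of determinant `1` all of whose relevant values are at least
`√(4/3)` is hexagonal. -/
theorem reduced_form_eq {A B C m : ℝ} (hm : 0 < m) (hm2 : m ^ 2 = 4 / 3) (hA : m ≤ A)
    (hC : m ≤ C) (hB : B ≤ 0) (hAB : 0 ≤ A + 2 * B) (hCB : 0 ≤ C + 2 * B)
    (hdet : A * C - B ^ 2 = 1) : A = m ∧ C = m ∧ A + 2 * B + C = m := by
  have hAC : A * C ≤ 4 / 3 := by
    nlinarith [mul_nonneg hAB (hm.le.trans hC), mul_nonneg (neg_nonneg.2 hB) hCB]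
  have hA' : A = m := by
    refine le_antisymm (le_of_mul_le_mul_right ?_ hm) hA
    nlinarith
  have hC' : C = m := by
    refine le_antisymm (le_of_mul_le_mul_right ?_ hm) hC
    nlinarith
  subst hA'
  subst hC'
  refine ⟨rfl, rfl, ?_⟩
  nlinarith

end NearlyMinimal

open NearlyMinimal in
/-- A lattice in `ℝ²` of covolume `1` whose nonzero vectors all have length at
least `(4/3)^{1/4}` has more than five nearly minimal vectors, i.e. vectors `x`
with `(4/3)^{1/4} ≤ ‖x‖ < 1.114`. -/
theorem more_than_five_nearly_minimal (Λ : Submodule ℤ (EuclideanSpace ℝ (Fin 2)))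
    [DiscreteTopology Λ] [IsZLattice ℝ Λ]
    (hcovol : ZLattice.covolume Λ = 1)
    (hmin : ∀ x ∈ Λ, x ≠ 0 → ((4 : ℝ) / 3) ^ ((1 : ℝ) / 4) ≤ ‖x‖) :
    ∃ s : Finset (EuclideanSpace ℝ (Fin 2)),
      (↑s : Set (EuclideanSpace ℝ (Fin 2))) ⊆
        {x | x ∈ Λ ∧ ((4 : ℝ) / 3) ^ ((1 : ℝ) / 4) ≤ ‖x‖ ∧ ‖x‖ < 1.114} ∧
      5 < s.card := by
  classical
  obtain ⟨u, hu, v, hv, huv, hB, hpair⟩ :=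
    exists_minimal_obtuse_pair Λ (exists_area_sq_eq_one Λ hcovol)
  set t : ℝ := ((4 : ℝ) / 3) ^ ((1 : ℝ) / 4) with ht
  have ht0 : 0 < t := by positivity
  have ht4 : (t ^ 2) ^ 2 = 4 / 3 := by
    rw [← pow_mul, ht, ← Real.rpow_natCast, ← Real.rpow_mul (by norm_num)]
    norm_num
  let f : ℤ × ℤ → EuclideanSpace ℝ (Fin 2) := fun p => p.1 • u + p.2 • v
  have hfΛ (p : ℤ × ℤ) : f p ∈ Λ := Λ.add_mem (Λ.smul_mem _ hu) (Λ.smul_mem _ hv)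
  have hf0 (p : ℤ × ℤ) : f p 0 = p.1 * u 0 + p.2 * v 0 := by simp [f]
  have hf1 (p : ℤ × ℤ) : f p 1 = p.1 * u 1 + p.2 * v 1 := by simp [f]
  have harea : area u v ≠ 0 := by
    intro h
    simp [h] at huv
  have hf : Function.Injective f := by
    intro p q h
    have h0 : f p 0 = f q 0 := by rw [h]
    have h1 : f p 1 = f q 1 := by rw [h]
    rw [hf0, hf0] at h0
    rw [hf1, hf1] at h1
    refine Prod.ext ?_ ?_
    · have : (p.1 : ℝ) = q.1 := mul_right_cancel₀ harea (by
        simp only [area]; linear_combination v 1 * h0 - v 0 * h1)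
      exact_mod_cast this
    · have : (p.2 : ℝ) = q.2 := mul_right_cancel₀ harea (by
        simp only [area]; linear_combination u 0 * h1 - u 1 * h0)
      exact_mod_cast this
  have hft (p : ℤ × ℤ) (hp : p ≠ 0) : t ≤ ‖f p‖ :=
    hmin _ (hfΛ p) fun h => hp (hf (by rw [h]; simp [f]))
  have hsq (p : ℤ × ℤ) (hp : p ≠ 0) : t ^ 2 ≤ ‖f p‖ ^ 2 :=
    pow_le_pow_left₀ ht0.le (hft p hp) 2
  have hA := hsq (1, 0) (by decide)
  have hC := hsq (0, 1) (by decide)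
  have hAB := hpair u hu (u + v) (Λ.add_mem hu hv) (by
    rw [← huv]; simp only [area, PiLp.add_apply]; ring)
  have hCB := hpair (u + v) (Λ.add_mem hu hv) v hv (by
    rw [← huv]; simp only [area, PiLp.add_apply]; ring)
  simp only [norm_sq_coord, hf0, hf1, PiLp.add_apply, Int.cast_one, Int.cast_zero] at hA hC hAB hCB
  obtain ⟨hA', hC', hABC⟩ := reduced_form_eq (A := u 0 ^ 2 + u 1 ^ 2)
    (B := u 0 * v 0 + u 1 * v 1) (C := v 0 ^ 2 + v 1 ^ 2) (pow_pos ht0 2) ht4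
    (by linarith) (by linarith) hB (by linarith) (by linarith) (by
      rw [← huv]; simp only [area]; ring)
  let T : Finset (ℤ × ℤ) := {(1, 0), (-1, 0), (0, 1), (0, -1), (1, 1), (-1, -1)}
  refine ⟨T.image f, ?_, ?_⟩
  · intro x hx
    obtain ⟨p, hp, rfl⟩ := Finset.mem_image.1 (Finset.mem_coe.1 hx)
    have hnorm : ‖f p‖ ^ 2 = t ^ 2 := by
      rw [norm_sq_coord, hf0, hf1]
      simp only [T, Finset.mem_insert, Finset.mem_singleton] at hp
      rcases hp with rfl | rfl | rfl | rfl | rfl | rfl <;> push_cast <;> linarith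
    refine ⟨hfΛ p, hft p ?_, ?_⟩
    · rintro rfl
      exact absurd hp (by decide)
    · refine lt_of_pow_lt_pow_left₀ 2 (by norm_num) ?_
      rw [hnorm]
      refine lt_of_pow_lt_pow_left₀ 2 (by positivity) ?_
      rw [ht4]
      norm_num
  · rw [Finset.card_image_of_injective _ hf]
    decide
end

section
/- Strict local optimality of the hexagonal form: let a, b, c ∈ ℝ with ρ := max{|a|, |b|, |c|} satisfying 0 < ρ < 12/47. Let D_ρ = (2+a)(2+c) − (1+b)² and let M_ρ be the minimum over (s,t) ∈ ℤ² \ {(0,0)} of the quadratic form Q_ρ(s,t) = (2+a)s² + 2(1+b)st + (2+c)t². Then either M_ρ / √(D_ρ) < 2/√3, or Q_ρ is proportional to the hexagonal form Q(s,t) = 2s² + 2st + 2t², i.e. there exists λ > 0 with (2+a, 1+b, 2+c) = λ·(2, 1, 2) (equivalently a = 2b and c = 2b). -/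
/-- A binary form with positive coefficients that takes values at least `m` at `(1,0)`, `(0,1)`
and `(1,-1)`, and whose diagonal coefficients are close, has determinant at least `3 m² / 4`, with
equality only for multiples of the hexagonal form. -/
theorem three_mul_sq_lt_four_mul_det_or_hexagonal {A B C m : ℝ} (hm : 0 < m) (hB : 0 < B)
    (hA : m ≤ A) (hC : m ≤ C) (hABC : m ≤ A - 2 * B + C) (hd : |A - C| < 2 * m) :
    3 * m ^ 2 < 4 * (A * C - B ^ 2) ∨ A = m ∧ 2 * B = m ∧ C = m := by
  by_cases heq : A = m ∧ C = m
  · obtain ⟨hAm, hCm⟩ := heq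
    rcases eq_or_lt_of_le (show 2 * B ≤ m by linarith) with h | h
    · exact Or.inr ⟨hAm, h, hCm⟩
    · left
      rw [hAm, hCm]
      nlinarith
  · left
    have hsum : 0 < (A - m) + (C - m) := by
      rcases eq_or_lt_of_le hA with h | h
      · rcases eq_or_lt_of_le hC with h' | h'
        · exact absurd ⟨h.symm, h'.symm⟩ heq
        · linarith
      · linarith
    have hB2 : (2 * B) ^ 2 ≤ (A + C - m) ^ 2 :=
      pow_le_pow_left₀ (by linarith) (by linarith) 2
    have hle : |A - C| ≤ (A - m) + (C - m) := abs_le.2 ⟨by linarith, by linarith⟩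
    have hsq : (A - C) ^ 2 < 2 * m * ((A - m) + (C - m)) := by
      rw [← sq_abs]
      nlinarith [abs_nonneg (A - C)]
    nlinarith

/-- Strict local optimality of the hexagonal quadratic form: if the form
`Q_ρ(s,t) = (2+a)s² + 2(1+b)st + (2+c)t²` is a perturbation of the hexagonal
form with `0 < ρ = max{|a|,|b|,|c|} < 12/47`, then either its normalized
density invariant `M_ρ/√(D_ρ)` is strictly less than `2/√3`, or `Q_ρ` is
proportional to the hexagonal form. -/
theorem hexagonal_form_strict_local_optimum (a b c : ℝ)
    (hρpos : 0 < max |a| (max |b| |c|))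
    (hρsmall : max |a| (max |b| |c|) < 12 / 47)
    (M : ℝ)
    (hM : IsLeast {m : ℝ | ∃ s t : ℤ, (s, t) ≠ (0, 0) ∧
        m = (2 + a) * (s : ℝ) ^ 2 + 2 * (1 + b) * (s : ℝ) * (t : ℝ)
          + (2 + c) * (t : ℝ) ^ 2} M) :
    M / Real.sqrt ((2 + a) * (2 + c) - (1 + b) ^ 2) < 2 / Real.sqrt 3 ∨
    ∃ l : ℝ, 0 < l ∧ 2 + a = l * 2 ∧ 1 + b = l * 1 ∧ 2 + c = l * 2 := by
  rw [max_lt_iff, max_lt_iff, abs_lt, abs_lt, abs_lt] at hρsmall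
  obtain ⟨⟨ha1, ha2⟩, ⟨hb1, hb2⟩, hc1, hc2⟩ := hρsmall
  have hMA : M ≤ 2 + a := hM.2 ⟨1, 0, by simp, by simp⟩
  have hMC : M ≤ 2 + c := hM.2 ⟨0, 1, by simp, by simp⟩
  have hMABC : M ≤ (2 + a) - 2 * (1 + b) + (2 + c) :=
    hM.2 ⟨1, -1, by simp, by push_cast; ring⟩
  have hD : 1 < (2 + a) * (2 + c) - (1 + b) ^ 2 := by nlinarith
  have key : 0 < M → 3 * M ^ 2 < 4 * ((2 + a) * (2 + c) - (1 + b) ^ 2) →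
      M / Real.sqrt ((2 + a) * (2 + c) - (1 + b) ^ 2) < 2 / Real.sqrt 3 := by
    intro hM0 h
    rw [div_lt_div_iff₀ (Real.sqrt_pos.2 (by linarith)) (by positivity)]
    refine lt_of_pow_lt_pow_left₀ 2 (by positivity) ?_
    rw [mul_pow, mul_pow, Real.sq_sqrt (by norm_num), Real.sq_sqrt (by linarith)]
    linarith
  rcases le_or_gt M 0 with hM0 | hM0
  · exact Or.inl ((div_nonpos_of_nonpos_of_nonneg hM0 (Real.sqrt_nonneg _)).trans_lt
      (by positivity))
  rcases le_or_gt M 1 with hM1 | hM1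
  · exact Or.inl (key hM0 (by nlinarith))
  rcases three_mul_sq_lt_four_mul_det_or_hexagonal hM0 (by linarith) hMA hMC hMABC
    (abs_lt.2 ⟨by linarith, by linarith⟩) with h | ⟨hA, hB, hC⟩
  · exact Or.inl (key hM0 h)
  · exact Or.inr ⟨M / 2, by linarith, by linarith, by linarith, by linarith⟩
end
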